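/- Let (X, 𝒜, ρ) be a measure space with ρ σ-finite, and let p, q : X → ℝ be measurable functions with p x > 0 and q x > 0 for ρ-almost every x, such that ∫ p dρ = 1 and ∫ q dρ = 1 and the integrals ∫ p·log(p/(p+q)) dρ and ∫ q·log(q/(p+q)) dρ are finite. Then for every measurable D : X → ℝ with 0 < D x < 1 ρ-almost everywhere such that ∫ p·log(D) dρ and ∫ q·log(1−D) dρ are well-defined, one has ∫ [p x · log(D x) + q x · log(1 − D x)] dρ(x) ≤ ∫ [p x · log(p x/(p x + q x)) + q x · log(q x/(p x + q x))] dρ(x). -/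

import Mathlib

open MeasureTheory

theorem mul_log_le_mul_log_div_add {a s y : ℝ} (ha : 0 < a) (hs : 0 < s) (hy : 0 < y) :
    a * Real.log y ≤ a * Real.log (a / s) + (y * s - a) := by
  have h := Real.log_le_sub_one_of_pos (div_pos hy (div_pos ha hs))
  rw [Real.log_div hy.ne' (div_pos ha hs).ne'] at h
  have h_mul := mul_le_mul_of_nonneg_left h ha.le
  have h_eq : a * (y / (a / s) - 1) = y * s - a := by
    field_simp
  linarith

/-- The function `y ↦ a * log y + b * log (1 - y)` on `(0, 1)` is maximized at `a / (a + b)`. -/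
theorem mul_log_add_mul_log_one_sub_le {a b y : ℝ} (ha : 0 < a) (hb : 0 < b)
    (hy0 : 0 < y) (hy1 : y < 1) :
    a * Real.log y + b * Real.log (1 - y) ≤
      a * Real.log (a / (a + b)) + b * Real.log (b / (a + b)) := by
  linarith [mul_log_le_mul_log_div_add ha (add_pos ha hb) hy0,
    mul_log_le_mul_log_div_add hb (add_pos ha hb) (sub_pos.2 hy1)]

/-- Measure-theoretic optimal-comparator step: for densities `p, q` with respect
to a σ-finite measure `ρ`, any comparator `D` with values in `(0,1)` a.e. has
cross-entropy objective no larger than that of `D*(x) = p x / (p x + q x)`. -/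
theorem optimal_comparator_measure {X : Type*} [MeasurableSpace X]
    (ρ : Measure X) [SigmaFinite ρ]
    (p q : X → ℝ) (hpm : Measurable p) (hqm : Measurable q)
    (hp : ∀ᵐ x ∂ρ, 0 < p x) (hq : ∀ᵐ x ∂ρ, 0 < q x)
    (hp1 : ∫ x, p x ∂ρ = 1) (hq1 : ∫ x, q x ∂ρ = 1)
    (hintp : Integrable (fun x => p x * Real.log (p x / (p x + q x))) ρ)
    (hintq : Integrable (fun x => q x * Real.log (q x / (p x + q x))) ρ)
    (D : X → ℝ) (hDm : Measurable D)
    (hD : ∀ᵐ x ∂ρ, 0 < D x ∧ D x < 1)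
    (hintD : Integrable (fun x => p x * Real.log (D x)) ρ)
    (hintD' : Integrable (fun x => q x * Real.log (1 - D x)) ρ) :
    ∫ x, (p x * Real.log (D x) + q x * Real.log (1 - D x)) ∂ρ ≤
      ∫ x, (p x * Real.log (p x / (p x + q x)) +
        q x * Real.log (q x / (p x + q x))) ∂ρ := by
  refine integral_mono_ae (hintD.add hintD') (hintp.add hintq) ?_
  filter_upwards [hp, hq, hD] with x hpx hqx hDx
  exact mul_log_add_mul_log_one_sub_le hpx hqx hDx.1 hDx.2
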